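/- Let d ∈ ℕ, c ∈ [1,∞), and let p¹,…,p^d be probability kernels on [0,1] such that for every k ∈ {1,…,d}, every m' ∈ {0,1,2}, and every φ ∈ C^{m'}([0,1],ℝ) the function z ↦ ∫ φ(y) p^k(z,dy) belongs to C^{m'}([0,1],ℝ) and satisfies ‖z ↦ ∫ φ(y) p^k(z,dy)‖_{C^{m'}} ≤ c ‖φ‖_{C^{m'}}. Then for every f ∈ C²([0,1]^d,ℝ) and every i, j ∈ {1,…,d} the mixed second partial derivative [0,1]^d ∋ x ↦ (∂²/∂x_i∂x_j) ∫ f(y) ⊗_{k=1}^d p^k(x_k,dy_k), where the integral is with respect to the product measure ⊗_{k=1}^d p^k(x_k,·), exists and is continuous on [0,1]^d. -/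

import Mathlib

open MeasureTheory Filter

noncomputable section

/-- The unit cube `[0,1]^d` in `ℝ^d`. -/
def cube (d : ℕ) : Set (Fin d → ℝ) := Set.univ.pi fun _ => Set.Icc (0:ℝ) 1

/-- Partial derivative in coordinate `i` (within `[0,1]`, i.e. one-sided at the boundary). -/
def pd (d : ℕ) (i : Fin d) (g : (Fin d → ℝ) → ℝ) : (Fin d → ℝ) → ℝ :=
  fun x => derivWithin (fun t => g (Function.update x i t)) (Set.Icc (0:ℝ) 1) (x i)

/-- Iterated partial derivative `∂^α` (coordinates applied in a fixed order). -/
def mderiv (d : ℕ) (α : Fin d → ℕ) (f : (Fin d → ℝ) → ℝ) : (Fin d → ℝ) → ℝ :=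
  List.foldr (fun i g => (pd d i)^[α i] g) f (List.finRange d)

/-- `f ∈ C^m([0,1]^d, ℝ)`: all partial derivatives of order `0` through `m` exist
(one-sidedly at the boundary) and are continuous on the cube. -/
def MemCm (d : ℕ) : ℕ → ((Fin d → ℝ) → ℝ) → Prop
  | 0, f => ContinuousOn f (cube d)
  | m + 1, f => ContinuousOn f (cube d) ∧ ∀ i : Fin d,
      (∀ x ∈ cube d, DifferentiableWithinAt ℝ (fun t => f (Function.update x i t))
        (Set.Icc (0:ℝ) 1) (x i)) ∧
      MemCm d m (pd d i f)

/-- Sup norm over the cube: `‖g‖_∞ = sup_{x ∈ [0,1]^d} |g(x)|`. -/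
def supCube (d : ℕ) (g : (Fin d → ℝ) → ℝ) : ℝ := ⨆ x : cube d, |g x.1|

/-- The `C^m`-norm: `max_{|α| ≤ m} sup_{x ∈ [0,1]^d} |∂^α f(x)|`. -/
def CmNorm (d m : ℕ) (f : (Fin d → ℝ) → ℝ) : ℝ :=
  ⨆ α : {α : Fin d → ℕ // (∑ i, α i) ≤ m}, supCube d (mderiv d α.1 f)

/-- `λ_m := max_{0 < |α| ≤ m} ∑_i ‖∂^α b_i‖_∞`. -/
def lamNorm (d m : ℕ) (b : Fin d → (Fin d → ℝ) → ℝ) : ℝ :=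
  ⨆ α : {α : Fin d → ℕ // 0 < (∑ i, α i) ∧ (∑ i, α i) ≤ m},
    ∑ i, supCube d (mderiv d α.1 (b i))

/-- One-sided derivative within `[0,1]` for a one-dimensional function. -/
noncomputable def dI (φ : ℝ → ℝ) : ℝ → ℝ := fun z => derivWithin φ (Set.Icc (0:ℝ) 1) z

/-- `φ ∈ C^m([0,1], ℝ)`: derivatives of order `0` through `m` exist
(one-sidedly at the boundary) and are continuous on `[0,1]`. -/
def MemC1d : ℕ → (ℝ → ℝ) → Prop
  | 0, φ => ContinuousOn φ (Set.Icc (0:ℝ) 1)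
  | m + 1, φ => ContinuousOn φ (Set.Icc (0:ℝ) 1) ∧
      (∀ z ∈ Set.Icc (0:ℝ) 1, DifferentiableWithinAt ℝ φ (Set.Icc (0:ℝ) 1) z) ∧
      MemC1d m (dI φ)

/-- The `C^m`-norm of a one-dimensional function: `max_{k ≤ m} sup_{z ∈ [0,1]} |φ^{(k)}(z)|`. -/
noncomputable def C1dNorm (m : ℕ) (φ : ℝ → ℝ) : ℝ :=
  ⨆ k : Fin (m + 1), ⨆ z : Set.Icc (0:ℝ) 1, |dI^[(k : ℕ)] φ z.1|

/-- `PEC d [i₁, …, i_n] g` means: the successive partial derivatives of `g` in the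
coordinates `i₁, …, i_n` (in this order, one-sided at the boundary) exist at every point
of the cube, and the final `n`-th order partial derivative is continuous on the cube. -/
def PEC (d : ℕ) : List (Fin d) → ((Fin d → ℝ) → ℝ) → Prop
  | [], g => ContinuousOn g (cube d)
  | i :: L, g => (∀ x ∈ cube d, DifferentiableWithinAt ℝ
      (fun t => g (Function.update x i t)) (Set.Icc (0:ℝ) 1) (x i)) ∧
      PEC d L (pd d i g)

section OneDimensional

/-- A mean value inequality on the part of `[0,1]` close to `a`. -/
lemma abs_sub_sub_le_of_hasDerivWithinAt_near {F F' : ℝ → ℝ} {a s δ e C : ℝ}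
    (ha : a ∈ Set.Icc (0:ℝ) 1) (hs : s ∈ Set.Icc (0:ℝ) 1) (hsδ : |s - a| < δ)
    (hF : ∀ r ∈ Set.Icc (0:ℝ) 1, |r - a| < δ → HasDerivWithinAt F (F' r) (Set.Icc 0 1) r)
    (hC : ∀ r ∈ Set.Icc (0:ℝ) 1, |r - a| < δ → |F' r - e| ≤ C) :
    |F s - F a - (s - a) * e| ≤ C * |s - a| := by
  have hδ : 0 < δ := (abs_nonneg _).trans_lt hsδ
  have hconv : Convex ℝ (Set.Icc (0:ℝ) 1 ∩ Metric.ball a δ) :=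
    (convex_Icc 0 1).inter (convex_ball a δ)
  have hball : ∀ r, r ∈ Metric.ball a δ ↔ |r - a| < δ := fun r => by
    rw [Metric.mem_ball, Real.dist_eq]
  have h := hconv.norm_image_sub_le_of_norm_hasDerivWithin_le
    (f := fun r => F r - r * e) (f' := fun r => F' r - e) (C := C) (x := a) (y := s)
    (fun r hr => by
      have h1 := (hF r hr.1 ((hball r).1 hr.2)).mono
        (Set.inter_subset_left : Set.Icc (0:ℝ) 1 ∩ Metric.ball a δ ⊆ _)
      exact h1.sub (((hasDerivWithinAt_id r _).mul_const e).congr_deriv (one_mul e)))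
    (fun r hr => hC r hr.1 ((hball r).1 hr.2))
    ⟨ha, Metric.mem_ball_self hδ⟩ ⟨hs, (hball s).2 hsδ⟩
  simp only [Real.norm_eq_abs] at h
  have : F s - F a - (s - a) * e = F s - s * e - (F a - a * e) := by ring
  rwa [this]

lemma hasDerivWithinAt_Icc_of_forall_eps {F : ℝ → ℝ} {a e : ℝ}
    (h : ∀ ε > 0, ∃ δ > 0, ∀ s ∈ Set.Icc (0:ℝ) 1, |s - a| < δ →
      |F s - F a - (s - a) * e| ≤ ε * |s - a|) :
    HasDerivWithinAt F e (Set.Icc 0 1) a := by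
  rw [hasDerivWithinAt_iff_isLittleO, Asymptotics.isLittleO_iff]
  intro ε hε
  obtain ⟨δ, hδ, H⟩ := h ε hε
  filter_upwards [self_mem_nhdsWithin, mem_nhdsWithin_of_mem_nhds (Metric.ball_mem_nhds a hδ)]
    with s hs hb
  rw [Metric.mem_ball, Real.dist_eq] at hb
  simpa using H s hs hb

lemma abs_deriv_le_of_forall_near {F : ℝ → ℝ} {a e C δ : ℝ} (ha : a ∈ Set.Icc (0:ℝ) 1)
    (hδ : 0 < δ) (hF : HasDerivWithinAt F e (Set.Icc 0 1) a)
    (h : ∀ z ∈ Set.Icc (0:ℝ) 1, |z - a| < δ → |F z - F a| ≤ C * |z - a|) : |e| ≤ C := by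
  have hne : (nhdsWithin a (Set.Icc (0:ℝ) 1 \ {a})).NeBot := by
    have := (uniqueDiffOn_Icc_zero_one a ha).accPt
    rwa [accPt_principal_iff_nhdsWithin] at this
  have ht := (hasDerivWithinAt_iff_tendsto_slope.1 hF).abs
  refine le_of_tendsto ht ?_
  filter_upwards [self_mem_nhdsWithin, mem_nhdsWithin_of_mem_nhds (Metric.ball_mem_nhds a hδ)]
    with z hz hb
  rw [Metric.mem_ball, Real.dist_eq] at hb
  have hpos : 0 < |z - a| := abs_pos.2 (sub_ne_zero.2 hz.2)
  rw [slope_def_field, abs_div, div_le_iff₀ hpos]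
  exact h z hz.1 hb

lemma MemC1d.continuousOn {m : ℕ} {φ : ℝ → ℝ} (h : MemC1d m φ) :
    ContinuousOn φ (Set.Icc 0 1) := by
  cases m with
  | zero => exact h
  | succ m => exact h.1

lemma MemC1d.continuousOn_iterate {m : ℕ} {φ : ℝ → ℝ} (h : MemC1d m φ) {l : ℕ} (hl : l ≤ m) :
    ContinuousOn (dI^[l] φ) (Set.Icc 0 1) := by
  induction l generalizing m φ with
  | zero => exact h.continuousOn
  | succ l ih =>
    obtain ⟨m, rfl⟩ : ∃ n, m = n + 1 := ⟨m - 1, by omega⟩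
    rw [Function.iterate_succ_apply]
    exact ih h.2.2 (by omega)

lemma MemC1d.of_eqOn_sub {m : ℕ} {φ ψ θ : ℝ → ℝ} (hφ : MemC1d m φ) (hψ : MemC1d m ψ)
    (h : Set.EqOn θ (φ - ψ) (Set.Icc 0 1)) : MemC1d m θ := by
  induction m generalizing φ ψ θ with
  | zero => exact (ContinuousOn.sub hφ hψ).congr h
  | succ m ih =>
    refine ⟨(hφ.1.sub hψ.1).congr h,
      fun z hz => ((hφ.2.1 z hz).sub (hψ.2.1 z hz)).congr h (h hz),
      ih hφ.2.2 hψ.2.2 fun z hz => ?_⟩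
    simp only [dI, Pi.sub_apply]
    rw [derivWithin_congr h (h hz), derivWithin_sub (hφ.2.1 z hz) (hψ.2.1 z hz)]

lemma dI_iterate_eqOn_sub {m l : ℕ} (hl : l ≤ m) {φ ψ θ : ℝ → ℝ} (hφ : MemC1d m φ)
    (hψ : MemC1d m ψ) (h : Set.EqOn θ (φ - ψ) (Set.Icc 0 1)) :
    Set.EqOn (dI^[l] θ) (dI^[l] φ - dI^[l] ψ) (Set.Icc 0 1) := by
  induction l generalizing m φ ψ θ with
  | zero => exact h
  | succ l ih =>
    obtain ⟨m, rfl⟩ : ∃ n, m = n + 1 := ⟨m - 1, by omega⟩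
    simp only [Function.iterate_succ_apply]
    refine ih (m := m) (by omega) hφ.2.2 hψ.2.2 fun z hz => ?_
    simp only [dI, Pi.sub_apply]
    rw [derivWithin_congr h (h hz), derivWithin_sub (hφ.2.1 z hz) (hψ.2.1 z hz)]

lemma MemC1d.abs_iterate_le_C1dNorm {m : ℕ} {φ : ℝ → ℝ} (h : MemC1d m φ) {l : ℕ} (hl : l ≤ m)
    {z : ℝ} (hz : z ∈ Set.Icc (0:ℝ) 1) : |dI^[l] φ z| ≤ C1dNorm m φ := by
  have hbdd : BddAbove (Set.range fun z : Set.Icc (0:ℝ) 1 => |dI^[l] φ z.1|) := by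
    have := isCompact_Icc.bddAbove_image (h.continuousOn_iterate hl).abs
    rwa [Set.image_eq_range] at this
  refine (le_ciSup hbdd ⟨z, hz⟩).trans ?_
  exact le_ciSup (f := fun k : Fin (m + 1) => ⨆ z : Set.Icc (0:ℝ) 1, |dI^[(k : ℕ)] φ z.1|)
    (Set.finite_range _).bddAbove ⟨l, by omega⟩

lemma C1dNorm_le {m : ℕ} {φ : ℝ → ℝ} {C : ℝ}
    (h : ∀ l ≤ m, ∀ z ∈ Set.Icc (0:ℝ) 1, |dI^[l] φ z| ≤ C) : C1dNorm m φ ≤ C := by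
  have : Nonempty (Set.Icc (0:ℝ) 1) := ⟨⟨0, by simp⟩⟩
  exact ciSup_le fun k => ciSup_le fun z => h k (by omega) z z.2

lemma integrable_of_continuousOn_Icc {μ : Measure ℝ} [IsFiniteMeasure μ]
    (hμ : μ (Set.Icc (0:ℝ) 1)ᶜ = 0) {φ : ℝ → ℝ} (hφ : ContinuousOn φ (Set.Icc 0 1)) :
    Integrable φ μ := by
  have h := hφ.integrableOn_compact (μ := μ) isCompact_Icc
  rwa [IntegrableOn, Measure.restrict_eq_self_of_ae_mem (measure_eq_zero_iff_ae_notMem.1 hμ |>.mono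
    fun x hx => by simpa using hx)] at h

end OneDimensional

section Cube

lemma mem_cube {d : ℕ} {x : Fin d → ℝ} : x ∈ cube d ↔ ∀ i, x i ∈ Set.Icc (0:ℝ) 1 := by
  exact Set.mem_univ_pi

lemma update_mem_cube {d : ℕ} {x : Fin d → ℝ} (hx : x ∈ cube d) (k : Fin d) {t : ℝ}
    (ht : t ∈ Set.Icc (0:ℝ) 1) : Function.update x k t ∈ cube d := by
  rw [mem_cube] at hx ⊢
  intro i
  by_cases h : i = k
  · subst h; simpa using ht
  · simpa [h] using hx i

lemma isCompact_cube (d : ℕ) : IsCompact (cube d) := isCompact_univ_pi fun _ => isCompact_Icc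

lemma exists_delta_of_continuousOn_cube {d : ℕ} {f : (Fin d → ℝ) → ℝ}
    (hf : ContinuousOn f (cube d)) {ε : ℝ} (hε : 0 < ε) :
    ∃ δ > 0, ∀ x ∈ cube d, ∀ y ∈ cube d, dist x y < δ → |f x - f y| < ε := by
  have := (isCompact_cube d).uniformContinuousOn_of_continuous hf
  rw [Metric.uniformContinuousOn_iff] at this
  simpa only [Real.dist_eq] using this ε hε

lemma dist_update_update_le {d : ℕ} (x y : Fin d → ℝ) (k : Fin d) (t : ℝ) :
    dist (Function.update x k t) (Function.update y k t) ≤ dist x y := by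
  refine (dist_pi_le_iff dist_nonneg).2 fun i => ?_
  by_cases h : i = k
  · subst h; simp
  · simpa [h] using dist_le_pi_dist x y i

lemma dist_update_self_le {d : ℕ} (x : Fin d → ℝ) (k : Fin d) (t : ℝ) :
    dist (Function.update x k t) x ≤ |t - x k| := by
  refine (dist_pi_le_iff (abs_nonneg _)).2 fun i => ?_
  by_cases h : i = k
  · subst h; simp [Real.dist_eq]
  · simp [h]

lemma pd_update {d : ℕ} (k : Fin d) (f : (Fin d → ℝ) → ℝ) (x : Fin d → ℝ) (t : ℝ) :
    pd d k f (Function.update x k t) = dI (fun r => f (Function.update x k r)) t := by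
  simp [pd, dI]

lemma pd_iterate_update {d : ℕ} (k : Fin d) (f : (Fin d → ℝ) → ℝ) (x : Fin d → ℝ) (l : ℕ) :
    (fun t => (pd d k)^[l] f (Function.update x k t))
      = dI^[l] (fun r => f (Function.update x k r)) := by
  induction l generalizing f with
  | zero => rfl
  | succ l ih =>
    rw [Function.iterate_succ_apply, Function.iterate_succ_apply, ih]
    congr 1
    exact funext fun t => pd_update k f x t

/-- `f` has a partial derivative in coordinate `i` at every point of the cube. -/
def DiffInCoord (d : ℕ) (i : Fin d) (f : (Fin d → ℝ) → ℝ) : Prop :=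
  ∀ x ∈ cube d, DifferentiableWithinAt ℝ (fun t => f (Function.update x i t))
    (Set.Icc (0:ℝ) 1) (x i)

lemma DiffInCoord.hasDerivWithinAt {d : ℕ} {i : Fin d} {f : (Fin d → ℝ) → ℝ}
    (h : DiffInCoord d i f) {x : Fin d → ℝ} (hx : x ∈ cube d) {r : ℝ}
    (hr : r ∈ Set.Icc (0:ℝ) 1) :
    HasDerivWithinAt (fun t => f (Function.update x i t)) (pd d i f (Function.update x i r))
      (Set.Icc 0 1) r := by
  have := h _ (update_mem_cube hx i hr)
  simp only [Function.update_idem, Function.update_self] at this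
  rw [pd_update]
  exact this.hasDerivWithinAt

lemma pd_eq_of_hasDerivWithinAt {d : ℕ} {i : Fin d} {f : (Fin d → ℝ) → ℝ} {x : Fin d → ℝ}
    (hx : x ∈ cube d) {e : ℝ}
    (h : HasDerivWithinAt (fun t => f (Function.update x i t)) e (Set.Icc 0 1) (x i)) :
    pd d i f x = e :=
  h.derivWithin (uniqueDiffOn_Icc_zero_one _ (mem_cube.1 hx i))

lemma eqOn_update {d : ℕ} {f g : (Fin d → ℝ) → ℝ} (h : Set.EqOn f g (cube d)) {x : Fin d → ℝ}
    (hx : x ∈ cube d) (i : Fin d) :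
    Set.EqOn (fun t => f (Function.update x i t)) (fun t => g (Function.update x i t))
      (Set.Icc 0 1) :=
  fun _ ht => h (update_mem_cube hx i ht)

lemma DiffInCoord.congr {d : ℕ} {i : Fin d} {f g : (Fin d → ℝ) → ℝ} (hg : DiffInCoord d i g)
    (h : Set.EqOn f g (cube d)) : DiffInCoord d i f := fun x hx =>
  (hg x hx).congr (eqOn_update h hx i) (eqOn_update h hx i (mem_cube.1 hx i))

lemma pd_congr {d : ℕ} {f g : (Fin d → ℝ) → ℝ} (h : Set.EqOn f g (cube d)) (i : Fin d) :
    Set.EqOn (pd d i f) (pd d i g) (cube d) := fun _ hx =>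
  derivWithin_congr (eqOn_update h hx i) (eqOn_update h hx i (mem_cube.1 hx i))

lemma MemCm.congr {d m : ℕ} {f g : (Fin d → ℝ) → ℝ} (hg : MemCm d m g)
    (h : Set.EqOn f g (cube d)) : MemCm d m f := by
  induction m generalizing f g with
  | zero => exact ContinuousOn.congr hg h
  | succ m ih =>
    exact ⟨hg.1.congr h, fun i => ⟨DiffInCoord.congr (hg.2 i).1 h,
      ih (hg.2 i).2 (pd_congr h i)⟩⟩

lemma MemCm.continuousOn {d m : ℕ} {f : (Fin d → ℝ) → ℝ} (hf : MemCm d m f) :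
    ContinuousOn f (cube d) := by
  cases m with
  | zero => exact hf
  | succ m => exact hf.1

lemma MemCm.of_succ {d m : ℕ} {f : (Fin d → ℝ) → ℝ} (hf : MemCm d (m + 1) f) : MemCm d m f := by
  induction m generalizing f with
  | zero => exact hf.1
  | succ m ih => exact ⟨hf.1, fun i => ⟨(hf.2 i).1, ih (hf.2 i).2⟩⟩

lemma MemCm.continuousOn_iterate {d m l : ℕ} {f : (Fin d → ℝ) → ℝ} (hf : MemCm d m f)
    (hl : l ≤ m) (k : Fin d) : ContinuousOn ((pd d k)^[l] f) (cube d) := by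
  induction l generalizing m f with
  | zero => exact hf.continuousOn
  | succ l ih =>
    obtain ⟨m, rfl⟩ : ∃ n, m = n + 1 := ⟨m - 1, by omega⟩
    rw [Function.iterate_succ_apply]
    exact ih (hf.2 k).2 (by omega)

lemma continuousOn_slice {d : ℕ} {f : (Fin d → ℝ) → ℝ} (hf : ContinuousOn f (cube d))
    {x : Fin d → ℝ} (hx : x ∈ cube d) (k : Fin d) :
    ContinuousOn (fun t => f (Function.update x k t)) (Set.Icc 0 1) :=
  hf.comp ((continuous_const (y := x)).update k continuous_id).continuousOn
    fun _ ht => update_mem_cube hx k ht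

lemma MemCm.memC1d_slice {d m : ℕ} {f : (Fin d → ℝ) → ℝ} (hf : MemCm d m f)
    {x : Fin d → ℝ} (hx : x ∈ cube d) (k : Fin d) :
    MemC1d m (fun t => f (Function.update x k t)) := by
  induction m generalizing f with
  | zero => exact continuousOn_slice hf hx k
  | succ m ih =>
    refine ⟨continuousOn_slice hf.1 hx k,
      fun z hz => (DiffInCoord.hasDerivWithinAt (hf.2 k).1 hx hz).differentiableWithinAt, ?_⟩
    have := ih (hf.2 k).2
    rwa [show (fun t => pd d k f (Function.update x k t)) = dI (fun r => f (Function.update x k r))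
      from funext fun t => pd_update k f x t] at this

/-- Schwarz's theorem on the cube, in the form which deduces the existence of one mixed partial
derivative from the continuity of the other one. -/
lemma hasDerivWithinAt_pd_of_continuousOn_pd_pd {d : ℕ} {j k : Fin d} (hjk : j ≠ k)
    {g : (Fin d → ℝ) → ℝ} (hj : DiffInCoord d j g) (hk : DiffInCoord d k g)
    (hjk' : DiffInCoord d k (pd d j g)) (hc : ContinuousOn (pd d k (pd d j g)) (cube d))
    {x : Fin d → ℝ} (hx : x ∈ cube d) :
    HasDerivWithinAt (fun t => pd d k g (Function.update x j t)) (pd d k (pd d j g) x)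
      (Set.Icc 0 1) (x j) := by
  set e := pd d k (pd d j g) x with he
  have hxj := mem_cube.1 hx j
  have hxk := mem_cube.1 hx k
  refine hasDerivWithinAt_Icc_of_forall_eps fun ε hε => ?_
  obtain ⟨δ, hδ, H⟩ := exists_delta_of_continuousOn_cube hc hε
  refine ⟨δ / 2, half_pos hδ, fun s hs hsδ => ?_⟩
  have hcube : ∀ r ∈ Set.Icc (0:ℝ) 1, ∀ w ∈ Set.Icc (0:ℝ) 1,
      Function.update (Function.update x j r) k w ∈ cube d := fun r hr w hw =>
    update_mem_cube (update_mem_cube hx j hr) k hw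
  have hmix : ∀ r ∈ Set.Icc (0:ℝ) 1, |r - x j| < δ / 2 → ∀ z ∈ Set.Icc (0:ℝ) 1,
      |z - x k| < δ / 2 →
      |pd d j g (Function.update (Function.update x j r) k z)
        - pd d j g (Function.update (Function.update x j r) k (x k)) - (z - x k) * e|
        ≤ ε * |z - x k| := by
    intro r hr hrδ z hz hzδ
    refine abs_sub_sub_le_of_hasDerivWithinAt_near
      (F := fun w => pd d j g (Function.update (Function.update x j r) k w)) hxk hz hzδ
      (fun w hw _ => hjk'.hasDerivWithinAt (update_mem_cube hx j hr) hw) fun w hw hwδ => ?_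
    refine (H _ (hcube r hr w hw) _ hx ?_).le
    have h1 := dist_update_self_le (Function.update x j r) k w
    have h2 := dist_update_self_le x j r
    rw [Function.update_of_ne hjk.symm] at h1
    linarith [dist_triangle (Function.update (Function.update x j r) k w)
      (Function.update x j r) x]
  have hsecond : ∀ z ∈ Set.Icc (0:ℝ) 1, |z - x k| < δ / 2 →
      |g (Function.update (Function.update x j s) k z)
        - g (Function.update (Function.update x j s) k (x k))
        - (g (Function.update (Function.update x j (x j)) k z)
        - g (Function.update (Function.update x j (x j)) k (x k)))
        - (s - x j) * ((z - x k) * e)| ≤ ε * |z - x k| * |s - x j| := by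
    intro z hz hzδ
    have hd : ∀ w ∈ Set.Icc (0:ℝ) 1, ∀ r ∈ Set.Icc (0:ℝ) 1,
        HasDerivWithinAt (fun r => g (Function.update (Function.update x j r) k w))
          (pd d j g (Function.update (Function.update x j r) k w)) (Set.Icc 0 1) r := by
      intro w hw r hr
      simp only [Function.update_comm hjk]
      exact hj.hasDerivWithinAt (update_mem_cube hx k hw) hr
    exact abs_sub_sub_le_of_hasDerivWithinAt_near
      (F := fun r => g (Function.update (Function.update x j r) k z)
        - g (Function.update (Function.update x j r) k (x k))) hxj hs hsδ
      (fun r hr _ => (hd z hz r hr).sub (hd _ hxk r hr))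
      (fun r hr hrδ => hmix r hr hrδ z hz hzδ)
  have hdk : ∀ r ∈ Set.Icc (0:ℝ) 1,
      HasDerivWithinAt (fun w => g (Function.update (Function.update x j r) k w))
        (pd d k g (Function.update x j r)) (Set.Icc 0 1) (x k) := by
    intro r hr
    have := hk.hasDerivWithinAt (update_mem_cube hx j hr) hxk
    rwa [show Function.update (Function.update x j r) k (x k) = Function.update x j r by
      rw [← Function.update_of_ne hjk.symm r x, Function.update_eq_self]] at this
  refine abs_deriv_le_of_forall_near hxk (half_pos hδ)
    (((hdk s hs).sub (hdk _ hxj)).sub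
      (((hasDerivWithinAt_id (x k) _).mul_const ((s - x j) * e)).congr_deriv (one_mul _))) ?_
  intro z hz hzδ
  refine (le_of_eq ?_).trans ((hsecond z hz hzδ).trans (le_of_eq (by ring)))
  congr 1
  simp only [Pi.sub_apply, id]
  ring

end Cube

section Kernel

/-- The action of the kernel `P` on the coordinate `k` of a function on the cube. -/
def coordKer (d : ℕ) (k : Fin d) (P : ℝ → Measure ℝ) (f : (Fin d → ℝ) → ℝ) : (Fin d → ℝ) → ℝ :=
  fun x => ∫ y, f (Function.update x k y) ∂ P (x k)

lemma coordKer_update {d : ℕ} (k : Fin d) (P : ℝ → Measure ℝ) (f : (Fin d → ℝ) → ℝ)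
    (x : Fin d → ℝ) :
    (fun t => coordKer d k P f (Function.update x k t))
      = fun z => ∫ y, f (Function.update x k y) ∂ P z := by
  simp [coordKer]

lemma pd_iterate_coordKer {d : ℕ} (k : Fin d) (P : ℝ → Measure ℝ) (f : (Fin d → ℝ) → ℝ)
    (x : Fin d → ℝ) (l : ℕ) :
    (pd d k)^[l] (coordKer d k P f) x
      = dI^[l] (fun z => ∫ y, f (Function.update x k y) ∂ P z) (x k) := by
  rw [← coordKer_update, ← pd_iterate_update]
  simp

variable {d : ℕ} {c : ℝ} {P : ℝ → Measure ℝ} [∀ z, IsProbabilityMeasure (P z)]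

lemma continuousOn_pd_iterate_coordKer (hc : 1 ≤ c) (hs : ∀ z, P z (Set.Icc (0:ℝ) 1)ᶜ = 0)
    {m : ℕ} (hP : ∀ φ : ℝ → ℝ, MemC1d m φ → MemC1d m (fun z => ∫ y, φ y ∂ P z) ∧
      C1dNorm m (fun z => ∫ y, φ y ∂ P z) ≤ c * C1dNorm m φ)
    (k : Fin d) {f : (Fin d → ℝ) → ℝ} (hf : MemCm d m f) :
    ContinuousOn ((pd d k)^[m] (coordKer d k P f)) (cube d) := by
  intro x₀ hx₀
  rw [Metric.continuousWithinAt_iff]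
  intro ε hε
  have hc0 : 0 < c := by linarith
  have hη : 0 < ε / (2 * c) := by positivity
  have hunif : ∃ δ > 0, ∀ x ∈ cube d, ∀ y ∈ cube d, dist x y < δ → ∀ l ≤ m,
      |(pd d k)^[l] f x - (pd d k)^[l] f y| ≤ ε / (2 * c) := by
    have h : ∀ l : Fin (m + 1), ∃ δ > 0, ∀ x ∈ cube d, ∀ y ∈ cube d, dist x y < δ →
        |(pd d k)^[(l : ℕ)] f x - (pd d k)^[(l : ℕ)] f y| < ε / (2 * c) := fun l =>
      exists_delta_of_continuousOn_cube (hf.continuousOn_iterate (by omega) k) hη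
    choose δ hδ H using h
    obtain ⟨i₀, -, hi₀⟩ := Finset.exists_min_image Finset.univ δ ⟨0, Finset.mem_univ _⟩
    exact ⟨δ i₀, hδ i₀, fun x hx y hy hxy l hl => (H ⟨l, by omega⟩ x hx y hy
      (hxy.trans_le (hi₀ _ (Finset.mem_univ _)))).le⟩
  obtain ⟨δ₁, hδ₁, H₁⟩ := hunif
  have hf₀ := hf.memC1d_slice hx₀ k
  have hcont := ((hP _ hf₀).1.continuousOn_iterate le_rfl) (x₀ k) (mem_cube.1 hx₀ k)
  rw [Metric.continuousWithinAt_iff] at hcont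
  obtain ⟨δ₂, hδ₂, H₂⟩ := hcont (ε / 2) (half_pos hε)
  refine ⟨min δ₁ δ₂, lt_min hδ₁ hδ₂, fun x hx hxd => ?_⟩
  have hxk := mem_cube.1 hx k
  have h2 := H₂ hxk ((dist_le_pi_dist x x₀ k).trans_lt (hxd.trans_le (min_le_right _ _)))
  rw [pd_iterate_coordKer, pd_iterate_coordKer]
  refine (dist_triangle _ (dI^[m] (fun z => ∫ y, f (Function.update x₀ k y) ∂ P z) (x k)) _).trans_lt
    ?_
  have hfx := hf.memC1d_slice hx k
  set φ : ℝ → ℝ := fun t => f (Function.update x k t)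
  set φ₀ : ℝ → ℝ := fun t => f (Function.update x₀ k t)
  have hdiff : MemC1d m (φ - φ₀) := hfx.of_eqOn_sub hf₀ fun _ _ => rfl
  have hT : Set.EqOn (fun z => ∫ y, (φ - φ₀) y ∂ P z)
      ((fun z => ∫ y, φ y ∂ P z) - fun z => ∫ y, φ₀ y ∂ P z) (Set.Icc 0 1) := fun z _ =>
    integral_sub (integrable_of_continuousOn_Icc (hs z) hfx.continuousOn)
      (integrable_of_continuousOn_Icc (hs z) hf₀.continuousOn)
  have h3 := dI_iterate_eqOn_sub le_rfl (hP _ hfx).1 (hP _ hf₀).1 hT hxk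
  have h4 := (hP _ hdiff).1.abs_iterate_le_C1dNorm le_rfl hxk
  have h5 : C1dNorm m (φ - φ₀) ≤ ε / (2 * c) := by
    refine C1dNorm_le fun l hl z hz => ?_
    rw [dI_iterate_eqOn_sub hl hfx hf₀ (fun _ _ => rfl) hz, Pi.sub_apply,
      ← pd_iterate_update, ← pd_iterate_update]
    exact H₁ _ (update_mem_cube hx k hz) _ (update_mem_cube hx₀ k hz)
      ((dist_update_update_le x x₀ k z).trans_lt (hxd.trans_le (min_le_left _ _))) l hl
  have h6 : c * C1dNorm m (φ - φ₀) ≤ ε / 2 :=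
    (mul_le_mul_of_nonneg_left h5 hc0.le).trans (le_of_eq (by field_simp))
  have h7 : dist (dI^[m] (fun z => ∫ y, φ y ∂ P z) (x k))
      (dI^[m] (fun z => ∫ y, φ₀ y ∂ P z) (x k)) ≤ ε / 2 := by
    rw [Real.dist_eq, ← Pi.sub_apply, ← h3]
    exact h4.trans ((hP _ hdiff).2.trans h6)
  linarith

lemma hasDerivWithinAt_coordKer_of_ne (hs : ∀ z, P z (Set.Icc (0:ℝ) 1)ᶜ = 0) {j k : Fin d}
    (hjk : j ≠ k) {f : (Fin d → ℝ) → ℝ} (hf : ContinuousOn f (cube d)) (hj : DiffInCoord d j f)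
    (hfj : ContinuousOn (pd d j f) (cube d)) {x : Fin d → ℝ} (hx : x ∈ cube d) :
    HasDerivWithinAt (fun t => coordKer d k P f (Function.update x j t))
      (coordKer d k P (pd d j f) x) (Set.Icc 0 1) (x j) := by
  refine hasDerivWithinAt_Icc_of_forall_eps fun ε hε => ?_
  obtain ⟨δ, hδ, H⟩ := exists_delta_of_continuousOn_cube hfj hε
  refine ⟨δ, hδ, fun s hsI hsδ => ?_⟩
  have hxj := mem_cube.1 hx j
  have hint : ∀ r ∈ Set.Icc (0:ℝ) 1,
      Integrable (fun y => f (Function.update (Function.update x j r) k y)) (P (x k)) :=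
    fun r hr => integrable_of_continuousOn_Icc (hs _)
      (continuousOn_slice hf (update_mem_cube hx j hr) k)
  have hint' : Integrable (fun y => pd d j f (Function.update x k y)) (P (x k)) :=
    integrable_of_continuousOn_Icc (hs _) (continuousOn_slice hfj hx k)
  simp only [coordKer, Function.update_of_ne hjk.symm]
  rw [← integral_const_mul, ← integral_sub (hint s hsI) (hint _ hxj),
    ← integral_sub (by exact (hint s hsI).sub (hint _ hxj)) (hint'.const_mul _)]
  have hae : ∀ᵐ y ∂ P (x k), y ∈ Set.Icc (0:ℝ) 1 :=
    (measure_eq_zero_iff_ae_notMem.1 (hs (x k))).mono fun y hy => by simpa using hy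
  rw [← Real.norm_eq_abs]
  refine (norm_integral_le_of_norm_le_const (C := ε * |s - x j|) ?_).trans_eq
    (by rw [probReal_univ, mul_one])
  filter_upwards [hae] with y hy
  have hxy := update_mem_cube hx k hy
  have hyj : Function.update x k y j = x j := Function.update_of_ne hjk _ _
  rw [Real.norm_eq_abs, Function.update_comm hjk, Function.update_comm hjk]
  refine abs_sub_sub_le_of_hasDerivWithinAt_near
    (F := fun r => f (Function.update (Function.update x k y) j r)) hxj hsI hsδ
    (fun r hr _ => hj.hasDerivWithinAt hxy hr) fun r hr hrδ => ?_
  refine (H _ (update_mem_cube hxy j hr) _ hxy ?_).le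
  refine (dist_update_self_le _ j r).trans_lt ?_
  rwa [hyj]

lemma pd_coordKer_eqOn_of_ne (hs : ∀ z, P z (Set.Icc (0:ℝ) 1)ᶜ = 0) {j k : Fin d}
    (hjk : j ≠ k) {f : (Fin d → ℝ) → ℝ} (hf : ContinuousOn f (cube d)) (hj : DiffInCoord d j f)
    (hfj : ContinuousOn (pd d j f) (cube d)) :
    Set.EqOn (pd d j (coordKer d k P f)) (coordKer d k P (pd d j f)) (cube d) := fun _ hx =>
  pd_eq_of_hasDerivWithinAt hx (hasDerivWithinAt_coordKer_of_ne hs hjk hf hj hfj hx)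

lemma diffInCoord_coordKer (hs : ∀ z, P z (Set.Icc (0:ℝ) 1)ᶜ = 0)
    (hP : ∀ φ : ℝ → ℝ, MemC1d 1 φ → MemC1d 1 (fun z => ∫ y, φ y ∂ P z))
    (j k : Fin d) {f : (Fin d → ℝ) → ℝ} (hf : MemCm d 1 f) :
    DiffInCoord d j (coordKer d k P f) := by
  intro x hx
  by_cases hjk : j = k
  · subst hjk
    rw [coordKer_update]
    exact (hP _ (hf.memC1d_slice hx j)).2.1 _ (mem_cube.1 hx j)
  · exact (hasDerivWithinAt_coordKer_of_ne hs hjk hf.1 (hf.2 j).1 (hf.2 j).2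
      hx).differentiableWithinAt

lemma MemCm.coordKer_one (hc : 1 ≤ c) (hs : ∀ z, P z (Set.Icc (0:ℝ) 1)ᶜ = 0)
    (hP : ∀ m ≤ 2, ∀ φ : ℝ → ℝ, MemC1d m φ → MemC1d m (fun z => ∫ y, φ y ∂ P z) ∧
      C1dNorm m (fun z => ∫ y, φ y ∂ P z) ≤ c * C1dNorm m φ)
    (k : Fin d) {f : (Fin d → ℝ) → ℝ} (hf : MemCm d 1 f) :
    MemCm d 1 (coordKer d k P f) := by
  refine ⟨continuousOn_pd_iterate_coordKer hc hs (hP 0 (by norm_num)) k hf.of_succ, fun j =>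
    ⟨diffInCoord_coordKer hs (fun φ hφ => (hP 1 (by norm_num) φ hφ).1) j k hf, ?_⟩⟩
  by_cases hjk : j = k
  · subst hjk
    exact continuousOn_pd_iterate_coordKer hc hs (hP 1 (by norm_num)) j hf
  · exact (continuousOn_pd_iterate_coordKer (m := 0) hc hs (hP 0 (by norm_num)) k
      (hf.2 j).2).congr (pd_coordKer_eqOn_of_ne hs hjk hf.1 (hf.2 j).1 (hf.2 j).2)

/-- A kernel acting on one coordinate preserves `C²`-regularity on the cube. -/
lemma MemCm.coordKer_two (hc : 1 ≤ c) (hs : ∀ z, P z (Set.Icc (0:ℝ) 1)ᶜ = 0)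
    (hP : ∀ m ≤ 2, ∀ φ : ℝ → ℝ, MemC1d m φ → MemC1d m (fun z => ∫ y, φ y ∂ P z) ∧
      C1dNorm m (fun z => ∫ y, φ y ∂ P z) ≤ c * C1dNorm m φ)
    (k : Fin d) {f : (Fin d → ℝ) → ℝ} (hf : MemCm d 2 f) :
    MemCm d 2 (coordKer d k P f) := by
  have hone := MemCm.coordKer_one hc hs hP k hf.of_succ
  have hne : ∀ j, j ≠ k → MemCm d 1 (pd d j (coordKer d k P f)) := fun j hjk =>
    (MemCm.coordKer_one hc hs hP k (hf.2 j).2).congr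
      (pd_coordKer_eqOn_of_ne hs hjk hf.1 (hf.2 j).1 (hf.2 j).2.1)
  refine ⟨hone.1, fun i => ⟨(hone.2 i).1, ?_⟩⟩
  by_cases hik : i = k
  · subst hik
    refine ⟨(hone.2 i).2, fun l => ?_⟩
    by_cases hli : l = i
    · subst hli
      refine ⟨fun x hx => ?_, continuousOn_pd_iterate_coordKer hc hs (hP 2 le_rfl) l hf⟩
      have := (hP 2 le_rfl _ (hf.memC1d_slice hx l)).1.2.2.2.1 _ (mem_cube.1 hx l)
      rw [← coordKer_update] at this
      convert this using 1
      exact funext fun t => pd_update l _ x t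
    · have hder := fun x (hx : x ∈ cube d) => hasDerivWithinAt_pd_of_continuousOn_pd_pd hli
        (hone.2 l).1 (hone.2 i).1 ((hne l hli).2 i).1 ((hne l hli).2 i).2 hx
      exact ⟨fun x hx => (hder x hx).differentiableWithinAt,
        ContinuousOn.congr ((hne l hli).2 i).2 fun x hx =>
          pd_eq_of_hasDerivWithinAt hx (hder x hx)⟩
  · exact hne i hik

end Kernel

section Product

lemma ae_pi_forall {d : ℕ} {μ : Fin d → Measure ℝ} [∀ i, IsProbabilityMeasure (μ i)]
    {q : Fin d → ℝ → Prop} (h : ∀ i, ∀ᵐ t ∂ μ i, q i t) :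
    ∀ᵐ y ∂ Measure.pi μ, ∀ i, q i (y i) :=
  ae_all_iff.2 fun i => Measure.tendsto_eval_ae_ae.eventually (h i)

lemma pi_update_eq_map {d : ℕ} (μ : Fin d → Measure ℝ) [∀ i, IsProbabilityMeasure (μ i)]
    (k : Fin d) (ν : Measure ℝ) [IsProbabilityMeasure ν] :
    Measure.pi (Function.update μ k ν)
      = (ν.prod (Measure.pi μ)).map (fun q => Function.update q.2 k q.1) := by
  have hprob : ∀ i, IsProbabilityMeasure (Function.update μ k ν i) := fun i => by
    by_cases h : i = k
    · subst h; simpa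
    · simpa [h] using inferInstanceAs (IsProbabilityMeasure (μ i))
  have hm : Measurable (fun q : ℝ × (Fin d → ℝ) => Function.update q.2 k q.1) :=
    (continuous_snd.update k continuous_fst).measurable
  refine Measure.pi_eq fun s hs => ?_
  rw [Measure.map_apply hm (MeasurableSet.univ_pi hs)]
  have hpre : (fun q : ℝ × (Fin d → ℝ) => Function.update q.2 k q.1) ⁻¹' Set.univ.pi s
      = s k ×ˢ Set.univ.pi (Function.update s k Set.univ) := by
    ext q
    simp only [Set.mem_preimage, Set.mem_univ_pi, Set.mem_prod]
    constructor
    · intro h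
      refine ⟨by simpa using h k, fun i => ?_⟩
      by_cases hi : i = k
      · subst hi; simp
      · simpa [hi] using h i
    · rintro ⟨h1, h2⟩ i
      by_cases hi : i = k
      · subst hi; simpa using h1
      · simpa [hi] using h2 i
  rw [hpre, Measure.prod_prod, Measure.pi_pi, ← Finset.mul_prod_erase _ _ (Finset.mem_univ k),
    ← Finset.mul_prod_erase _ (fun i => Function.update μ k ν i (s i)) (Finset.mem_univ k)]
  simp only [Function.update_self, measure_univ, one_mul]
  congr 1
  refine Finset.prod_congr rfl fun i hi => ?_
  simp [Finset.ne_of_mem_erase hi]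

lemma integral_pi_update {d : ℕ} (μ : Fin d → Measure ℝ) [∀ i, IsProbabilityMeasure (μ i)]
    (k : Fin d) (ν : Measure ℝ) [IsProbabilityMeasure ν] {f : (Fin d → ℝ) → ℝ}
    (hf : Continuous f) {C : ℝ} (hC : ∀ y, |f y| ≤ C) :
    ∫ y, f y ∂ Measure.pi (Function.update μ k ν)
      = ∫ z, ∫ y, f (Function.update y k z) ∂ Measure.pi μ ∂ ν := by
  have hm : Continuous (fun q : ℝ × (Fin d → ℝ) => Function.update q.2 k q.1) :=
    continuous_snd.update k continuous_fst
  have hint : Integrable (fun q : ℝ × (Fin d → ℝ) => f (Function.update q.2 k q.1))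
      (ν.prod (Measure.pi μ)) :=
    Integrable.of_bound (hf.comp hm).aestronglyMeasurable C (Eventually.of_forall fun _ => hC _)
  rw [pi_update_eq_map, integral_map hm.measurable.aemeasurable hf.aestronglyMeasurable,
    integral_prod _ hint]

/-- The product of the kernels `p k` for `k ∈ S` and of the identity kernels for `k ∉ S`. -/
def partialKernel {d : ℕ} (p : Fin d → ℝ → Measure ℝ) (S : Finset (Fin d)) (x : Fin d → ℝ) :
    Fin d → Measure ℝ :=
  fun k => if k ∈ S then p k (x k) else Measure.dirac (x k)

instance {d : ℕ} (p : Fin d → ℝ → Measure ℝ) [∀ k z, IsProbabilityMeasure (p k z)]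
    (S : Finset (Fin d)) (x : Fin d → ℝ) (k : Fin d) :
    IsProbabilityMeasure (partialKernel p S x k) := by
  unfold partialKernel
  split_ifs <;> infer_instance

lemma integral_partialKernel_empty {d : ℕ} (p : Fin d → ℝ → Measure ℝ)
    [∀ k z, IsProbabilityMeasure (p k z)] (f : (Fin d → ℝ) → ℝ) (x : Fin d → ℝ) :
    ∫ y, f y ∂ Measure.pi (partialKernel p ∅ x) = f x := by
  have h : ∀ᵐ y ∂ Measure.pi (partialKernel p ∅ x), ∀ i, y i = x i :=
    ae_pi_forall (q := fun i t => t = x i) fun i => by simp [partialKernel, ae_dirac_eq]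
  rw [integral_congr_ae (g := fun _ => f x) (h.mono fun y hy => congrArg f (funext hy))]
  simp

lemma integral_partialKernel_insert {d : ℕ} (p : Fin d → ℝ → Measure ℝ)
    [∀ k z, IsProbabilityMeasure (p k z)] {f : (Fin d → ℝ) → ℝ} (hf : Continuous f) {C : ℝ}
    (hC : ∀ y, |f y| ≤ C) {S : Finset (Fin d)} {k : Fin d} (hk : k ∉ S) :
    (fun x => ∫ y, f y ∂ Measure.pi (partialKernel p (insert k S) x))
      = coordKer d k (p k) (fun x => ∫ y, f y ∂ Measure.pi (partialKernel p S x)) := by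
  funext x
  have h1 : partialKernel p (insert k S) x
      = Function.update (partialKernel p S x) k (p k (x k)) := by
    funext i
    by_cases hi : i = k
    · subst hi; simp [partialKernel]
    · simp [partialKernel, hi]
  have h2 : ∀ z, partialKernel p S (Function.update x k z)
      = Function.update (partialKernel p S x) k (Measure.dirac z) := by
    intro z
    funext i
    by_cases hi : i = k
    · subst hi; simp [partialKernel, hk]
    · simp [partialKernel, hi]
  simp only [coordKer, h1, h2]
  rw [integral_pi_update _ k _ hf hC]
  refine integral_congr_ae (Eventually.of_forall fun z => ?_)
  simp only
  rw [integral_pi_update _ k _ hf hC, integral_dirac]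

lemma exists_continuous_bounded_eqOn_cube {d : ℕ} {f : (Fin d → ℝ) → ℝ}
    (hf : ContinuousOn f (cube d)) :
    ∃ g : (Fin d → ℝ) → ℝ, Continuous g ∧ (∃ C, ∀ y, |g y| ≤ C) ∧ Set.EqOn g f (cube d) := by
  let q : (Fin d → ℝ) → Fin d → ℝ := fun x i => Set.projIcc (0:ℝ) 1 zero_le_one (x i)
  have hq : Continuous q := continuous_pi fun i =>
    continuous_subtype_val.comp (continuous_projIcc.comp (continuous_apply i))
  have hqc : ∀ x, q x ∈ cube d := fun x => mem_cube.2 fun i => Subtype.coe_prop _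
  obtain ⟨C, hC⟩ := (isCompact_cube d).exists_bound_of_continuousOn hf
  refine ⟨fun x => f (q x), hf.comp_continuous hq hqc, ⟨C, fun y => hC _ (hqc y)⟩,
    fun x hx => congrArg f (funext fun i => ?_)⟩
  simp only [q]
  rw [Set.projIcc_of_mem _ (mem_cube.1 hx i)]

end Product

/-- Continuity of mixed second derivatives: if each kernel `p^k` maps `C^{m'}([0,1],ℝ)`
into itself with operator norm at most `c` for `m' ∈ {0,1,2}`, then for `f ∈ C²([0,1]^d,ℝ)`
and every `i, j` the mixed second partial derivative `∂²/(∂x_i ∂x_j)` of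
`x ↦ ∫ f(y) ⊗_{k=1}^d p^k(x_k,dy_k)` exists and is continuous on `[0,1]^d`. -/
theorem continuity_mixed_second_derivatives_product_kernel
    (d : ℕ) (hd : 0 < d) (c : ℝ) (hc : 1 ≤ c)
    (p : Fin d → ℝ → Measure ℝ)
    [∀ k z, IsProbabilityMeasure (p k z)]
    (hmeas : ∀ k : Fin d, Measurable (p k))
    (hsupp : ∀ k : Fin d, ∀ z, p k z (Set.Icc (0:ℝ) 1)ᶜ = 0)
    (hp : ∀ k : Fin d, ∀ m' ≤ 2, ∀ φ : ℝ → ℝ, MemC1d m' φ →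
      MemC1d m' (fun z => ∫ y, φ y ∂ p k z) ∧
      C1dNorm m' (fun z => ∫ y, φ y ∂ p k z) ≤ c * C1dNorm m' φ)
    (f : (Fin d → ℝ) → ℝ) (hf : MemCm d 2 f) (i j : Fin d) :
    PEC d [j, i]
      (fun x : Fin d → ℝ => ∫ y, f y ∂ Measure.pi (fun k => p k (x k))) := by
  obtain ⟨g, hg, ⟨C, hC⟩, hgf⟩ := exists_continuous_bounded_eqOn_cube hf.continuousOn
  have hS : ∀ S : Finset (Fin d),
      MemCm d 2 (fun x => ∫ y, g y ∂ Measure.pi (partialKernel p S x)) := by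
    intro S
    induction S using Finset.induction_on with
    | empty =>
      simp only [integral_partialKernel_empty]
      exact hf.congr hgf
    | insert k S hk ih =>
      rw [integral_partialKernel_insert p hg hC hk]
      exact MemCm.coordKer_two hc (hsupp k) (hp k) k ih
  have hG : MemCm d 2 (fun x : Fin d → ℝ => ∫ y, f y ∂ Measure.pi (fun k => p k (x k))) := by
    refine (hS Finset.univ).congr fun x _ => ?_
    have hx : partialKernel p Finset.univ x = fun k => p k (x k) := by
      funext k
      simp [partialKernel]
    simp only [hx]
    have hae : ∀ᵐ y ∂ Measure.pi (fun k => p k (x k)), ∀ i, y i ∈ Set.Icc (0:ℝ) 1 :=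
      ae_pi_forall (q := fun _ t => t ∈ Set.Icc (0:ℝ) 1) fun k =>
        (measure_eq_zero_iff_ae_notMem.1 (hsupp k (x k))).mono fun y hy => by simpa using hy
    exact integral_congr_ae (hae.mono fun y hy => (hgf (mem_cube.2 hy)).symm)
  exact ⟨(hG.2 j).1, ((hG.2 j).2.2 i).1, ((hG.2 j).2.2 i).2⟩

end
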